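/- arXiv:1807.06760 — 5 statements merged into one kernel-verified Lean document; each statement's English description precedes it below -/
import Mathlib

section
/- Let a, b, λ be real numbers with a ≠ 0. If 1 + a(λ − (a + b)) = 0 and λ(a³ + b³) = (a² + b²)(a² + b² − 1), then b(b − a)(a²(b − a) − b) = 0. -/
theorem stmt_3 (a b lam : ℝ) (ha : a ≠ 0)
    (h1 : 1 + a * (lam - (a + b)) = 0)
    (h2 : lam * (a ^ 3 + b ^ 3) = (a ^ 2 + b ^ 2) * (a ^ 2 + b ^ 2 - 1)) :
    b * (b - a) * (a ^ 2 * (b - a) - b) = 0 := by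
  linear_combination a * h2 - (a ^ 3 + b ^ 3) * h1
end

section
/- Let a, b be real numbers. If a²(b − a) = b and 5a² + 6b² + 3a²b² − 3a⁴ − 3ab = 0, then 5a² + 9b² = 0, and hence a = 0 and b = 0. -/
theorem stmt_4 (a b : ℝ)
    (h1 : a ^ 2 * (b - a) = b)
    (h2 : 5 * a ^ 2 + 6 * b ^ 2 + 3 * a ^ 2 * b ^ 2 - 3 * a ^ 4 - 3 * a * b = 0) :
    5 * a ^ 2 + 9 * b ^ 2 = 0 ∧ a = 0 ∧ b = 0 := by
  have h : 5 * a ^ 2 + 9 * b ^ 2 = 0 := by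
    linear_combination h2 - 3 * (a + b) * h1
  refine ⟨h, ?_, ?_⟩
  · exact pow_eq_zero_iff two_ne_zero |>.mp (by linarith [sq_nonneg a, sq_nonneg b])
  · exact pow_eq_zero_iff two_ne_zero |>.mp (by linarith [sq_nonneg a, sq_nonneg b])
end

section
/- Let a, b, λ be real numbers with a ≠ b, and set H = a + b. If 2(1 + a(λ − H))(b² + 3a²) = 3λb(a − b)² and 2(1 + b(λ − H))(3b² + a²) = 3λa(a − b)², then 3a² + 2ab + 3b² + 3(a + b)(a² + b²)(λ − H) = 0. -/
theorem stmt_6 (a b lam : ℝ) (hne : a ≠ b)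
    (H : ℝ) (hH : H = a + b)
    (h1 : 2 * (1 + a * (lam - H)) * (b ^ 2 + 3 * a ^ 2) = 3 * lam * b * (a - b) ^ 2)
    (h2 : 2 * (1 + b * (lam - H)) * (3 * b ^ 2 + a ^ 2) = 3 * lam * a * (a - b) ^ 2) :
    3 * a ^ 2 + 2 * a * b + 3 * b ^ 2 +
      3 * (a + b) * (a ^ 2 + b ^ 2) * (lam - H) = 0 := by
  subst hH
  refine mul_left_cancel₀ (mul_ne_zero two_ne_zero (sub_ne_zero.mpr hne)) ?_
  linear_combination a * h1 - b * h2
end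

section
/- Let a, b, λ be real numbers, set H = a + b and S = a² + b², and assume H ≠ 0. If λH(3S − H²) = 2S(S − 1) and 3a² + 2ab + 3b² + 3HS(λ − H) = 0, then (S − H²)(6S² − 3H²S + H²) = 0. -/
theorem stmt_7 (a b lam : ℝ) (H S : ℝ) (hH : H = a + b) (hS : S = a ^ 2 + b ^ 2)
    (hH0 : H ≠ 0)
    (h1 : lam * H * (3 * S - H ^ 2) = 2 * S * (S - 1))
    (h2 : 3 * a ^ 2 + 2 * a * b + 3 * b ^ 2 + 3 * H * S * (lam - H) = 0) :
    (S - H ^ 2) * (6 * S ^ 2 - 3 * H ^ 2 * S + H ^ 2) = 0 := by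
  have hq : 3 * a ^ 2 + 2 * a * b + 3 * b ^ 2 = 2 * S + H ^ 2 := by
    rw [hH, hS]
    ring
  rw [hq] at h2
  linear_combination (3 * S - H ^ 2) * h2 - 3 * S * h1
end

section
/- Let t and λ be real numbers with t ≠ 0, set S = 2t², and assume S ≥ 1. If 3(−tS + t/2 + Sλ/4) + (Sλ/4 − t/2) + (3/2)λS = 0 (equivalently 5λt = 3S − 1) and −2S² + 5λ²S − 8tλS + 6S + 8tλ = 0, then S = 3 and λ² = 128/75. -/
theorem stmt_13 (t lam : ℝ) (ht : t ≠ 0) (S : ℝ) (hS : S = 2 * t ^ 2) (hS1 : S ≥ 1)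
    (h1 : 3 * (-t * S + t / 2 + S * lam / 4) + (S * lam / 4 - t / 2) +
      (3 / 2) * lam * S = 0)
    (h2 : -2 * S ^ 2 + 5 * lam ^ 2 * S - 8 * t * lam * S + 6 * S + 8 * t * lam = 0) :
    S = 3 ∧ lam ^ 2 = 128 / 75 := by
  have hlin : 5 * lam * t = 3 * S - 1 :=
    mul_left_cancel₀ ht (by subst hS; linear_combination h1)
  have hsq : 25 * lam ^ 2 * S = 2 * (3 * S - 1) ^ 2 := by
    rw [← hlin, hS]
    ring
  have hfactor : (8 * S - 1) * (S - 3) = 0 := by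
    linear_combination (-5 / 2) * h2 + (1 / 2) * hsq - (4 * S - 4) * hlin
  have hS3 : S = 3 := by
    rcases mul_eq_zero.mp hfactor with h | h <;> linarith
  rw [hS3] at hsq
  exact ⟨hS3, by linarith⟩
end
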